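/- Let H ∈ (1/2, 1) and let c_H > 0 be defined by c_H² = H(2H−1)/β(2−2H, H−1/2), where β(a,b) = Γ(a)Γ(b)/Γ(a+b). Define K_H(t,s) = c_H s^{1/2−H} ∫ₛᵗ (u−s)^{H−3/2} u^{H−1/2} du for 0 < s < t and K_H(t,s) = 0 for s ≥ t. Then for all s, t > 0: ∫₀^{min(s,t)} K_H(t,u) K_H(s,u) du = (1/2)(t^{2H} + s^{2H} − |t−s|^{2H}). -/

import Mathlib

open MeasureTheory Set intervalIntegral

noncomputable section

lemma aux_beta {α β : ℝ} (hα : 0 < α) (hβ : 0 < β) :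
    ∫⁻ w in Ioo (0:ℝ) 1, ENNReal.ofReal (w ^ (α - 1) * (1 - w) ^ (β - 1))
      = ENNReal.ofReal (ProbabilityTheory.beta α β) := by
  have h := ProbabilityTheory.lintegral_betaPDF_eq_one hα hβ
  have hb := ProbabilityTheory.beta_pos hα hβ
  rw [ProbabilityTheory.lintegral_betaPDF] at h
  have h2 : ∀ x : ℝ, ENNReal.ofReal (1 / ProbabilityTheory.beta α β * x ^ (α - 1) * (1 - x) ^ (β - 1))
      = ENNReal.ofReal (1 / ProbabilityTheory.beta α β) * ENNReal.ofReal (x ^ (α - 1) * (1 - x) ^ (β - 1)) := by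
    intro x
    rw [← ENNReal.ofReal_mul (by positivity), mul_assoc]
  simp_rw [h2] at h
  rw [lintegral_const_mul _ (by fun_prop)] at h
  calc _ = ENNReal.ofReal (ProbabilityTheory.beta α β) * (ENNReal.ofReal (1 / ProbabilityTheory.beta α β) * ∫⁻ w in Ioo (0:ℝ) 1, ENNReal.ofReal (w ^ (α - 1) * (1 - w) ^ (β - 1))) := by
        rw [← mul_assoc, ← ENNReal.ofReal_mul hb.le, mul_one_div_cancel hb.ne', ENNReal.ofReal_one, one_mul]
    _ = _ := by rw [h, mul_one]

lemma aux_inner {a x y : ℝ} (ha : 0 < a) (ha2 : a < 1/2) (hx : 0 < x) (hxy : x < y) :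
    ∫⁻ u in Ioo (0:ℝ) x, ENNReal.ofReal ((u ^ (-a) * (x - u) ^ (a - 1) * x ^ a) *
        (u ^ (-a) * (y - u) ^ (a - 1) * y ^ a))
      = ENNReal.ofReal (ProbabilityTheory.beta (1 - 2 * a) a * (y - x) ^ (2 * a - 1)) := by
  have hy : 0 < y := hx.trans hxy
  have hD : 0 < y - x := sub_pos.2 hxy
  have him : (fun u : ℝ => u * (y - x) / (x * (y - u))) '' Ioo 0 x = Ioo 0 1 := by
    ext w
    constructor
    · rintro ⟨u, ⟨hu, hux⟩, rfl⟩
      have hQ : 0 < y - u := by linarith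
      refine ⟨by positivity, ?_⟩
      simp only
      rw [div_lt_one (by positivity)]
      nlinarith
    · rintro ⟨hw, hw1⟩
      have hE : 0 < y - x + w * x := by positivity
      refine ⟨w * x * y / (y - x + w * x), ⟨by positivity, ?_⟩, ?_⟩
      · rw [div_lt_iff₀ hE]
        nlinarith [mul_pos (mul_pos hx hD) (sub_pos.2 hw1)]
      · have : y - w * x * y / (y - x + w * x) = y * (y - x) / (y - x + w * x) := by
          field_simp; ring
        simp only
        rw [this]
        field_simp
  have hinj : InjOn (fun u : ℝ => u * (y - x) / (x * (y - u))) (Ioo 0 x) := by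
    rintro u ⟨hu, hux⟩ v ⟨hv, hvx⟩ h
    have hQ : 0 < y - u := by linarith
    have hQ' : 0 < y - v := by linarith
    simp only at h
    rw [div_eq_div_iff (by positivity) (by positivity)] at h
    have : (y - x) * x * y * (u - v) = 0 := by linear_combination h
    have h3 : (y - x) * x * y ≠ 0 := by positivity
    linarith [(mul_eq_zero.1 this).resolve_left h3]
  have hder : ∀ u ∈ Ioo 0 x, HasDerivWithinAt (fun u : ℝ => u * (y - x) / (x * (y - u)))
      ((y - x) * y / (x * (y - u) ^ 2)) (Ioo 0 x) u := by
    rintro u ⟨hu, hux⟩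
    have hQ : 0 < y - u := by linarith
    have h1 : HasDerivAt (fun u : ℝ => u * (y - x)) (1 * (y - x)) u := (hasDerivAt_id u).mul_const _
    have h2 : HasDerivAt (fun u : ℝ => x * (y - u)) (x * (-1)) u :=
      ((hasDerivAt_id u).const_sub y).const_mul x
    have h3 := h1.div h2 (by positivity)
    refine HasDerivAt.hasDerivWithinAt (h3.congr_deriv ?_)
    field_simp
    ring
  have key := lintegral_image_eq_lintegral_abs_deriv_mul measurableSet_Ioo hder hinj
    (fun w => ENNReal.ofReal (w ^ ((1 - 2 * a) - 1) * (1 - w) ^ (a - 1)))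
  rw [him, aux_beta (by linarith) ha] at key
  rw [ENNReal.ofReal_mul (ProbabilityTheory.beta_pos (by linarith) ha).le, key,
    ← lintegral_mul_const _ (by fun_prop)]
  refine setLIntegral_congr_fun measurableSet_Ioo ?_
  rintro u ⟨hu, hux⟩
  have hQ : 0 < y - u := by linarith
  have hP : 0 < x - u := by linarith
  have h1w : 1 - u * (y - x) / (x * (y - u)) = y * (x - u) / (x * (y - u)) := by
    field_simp; ring
  simp only
  rw [h1w, abs_of_pos (by positivity), ← ENNReal.ofReal_mul (by positivity),
    ← ENNReal.ofReal_mul (by positivity)]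
  congr 1
  generalize y - u = Q at *
  generalize x - u = P at *
  generalize y - x = D at *
  clear key him hinj hder h1w hxy
  have e1 : D * y / (x * Q ^ 2) = Real.exp (Real.log D + Real.log y - Real.log x - 2 * Real.log Q) := by
    rw [← Real.exp_log (show 0 < D * y / (x * Q ^ 2) by positivity),
      Real.log_div (by positivity) (by positivity), Real.log_mul (by positivity) (by positivity),
      Real.log_mul (by positivity) (by positivity), Real.log_pow]
    push_cast; ring_nf
  rw [e1, Real.rpow_def_of_pos (show 0 < u * D / (x * Q) by positivity),
    Real.rpow_def_of_pos (show 0 < y * P / (x * Q) by positivity),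
    Real.log_div (by positivity) (by positivity), Real.log_div (by positivity) (by positivity),
    Real.log_mul hu.ne' hD.ne', Real.log_mul hx.ne' hQ.ne', Real.log_mul hy.ne' hP.ne']
  simp only [Real.rpow_def_of_pos hu, Real.rpow_def_of_pos hx, Real.rpow_def_of_pos hy,
    Real.rpow_def_of_pos hP, Real.rpow_def_of_pos hQ, Real.rpow_def_of_pos hD, ← Real.exp_add]
  congr 1
  ring

def fbmG (a u x : ℝ) : ENNReal :=
  if u < x then ENNReal.ofReal (u ^ (-a) * (x - u) ^ (a - 1) * x ^ a) else 0

lemma fbmG_meas (a : ℝ) : Measurable (fun p : ℝ × ℝ => fbmG a p.1 p.2) := by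
  unfold fbmG
  exact Measurable.ite (measurableSet_lt measurable_fst measurable_snd) (by fun_prop) (by fun_prop)

lemma aux_inner2' {a x y : ℝ} (ha : 0 < a) (ha2 : a < 1/2) (hx : 0 < x) (hxy : x < y) :
    ∫⁻ u in Ioi (0:ℝ), fbmG a u x * fbmG a u y
      = ENNReal.ofReal (ProbabilityTheory.beta (1 - 2 * a) a * |x - y| ^ (2 * a - 1)) := by
  rw [abs_sub_comm, abs_of_pos (sub_pos.2 hxy), ← aux_inner ha ha2 hx hxy]
  have : (Ioo 0 x : Set ℝ) = Iio x ∩ Ioi 0 := by ext; simp [and_comm]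
  rw [this, ← Measure.restrict_restrict measurableSet_Iio, ← lintegral_indicator measurableSet_Iio]
  refine setLIntegral_congr_fun measurableSet_Ioi ?_
  intro u hu
  have hu : 0 < u := hu
  by_cases h : u < x
  · have h1 : 0 < x - u := by linarith
    simp only [fbmG, h, h.trans hxy, if_true, indicator, mem_Iio]
    rw [← ENNReal.ofReal_mul (by positivity)]
  · simp [fbmG, h]

lemma aux_inner2 {a x y : ℝ} (ha : 0 < a) (ha2 : a < 1/2) (hx : 0 < x) (hy : 0 < y) (hxy : x ≠ y) :
    ∫⁻ u in Ioi (0:ℝ), fbmG a u x * fbmG a u y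
      = ENNReal.ofReal (ProbabilityTheory.beta (1 - 2 * a) a * |x - y| ^ (2 * a - 1)) := by
  rcases lt_or_gt_of_ne hxy with h | h
  · exact aux_inner2' ha ha2 hx h
  · rw [abs_sub_comm, ← aux_inner2' ha ha2 hy h]
    simp_rw [mul_comm]

lemma aux_int {r : ℝ} (hr : -1 < r) (b c : ℝ) :
    IntervalIntegrable (fun z : ℝ => |z| ^ r) volume b c := by
  suffices h : ∀ c : ℝ, IntervalIntegrable (fun z : ℝ => |z| ^ r) volume 0 c from (h b).symm.trans (h c)
  have h0 : ∀ c : ℝ, 0 ≤ c → IntervalIntegrable (fun z : ℝ => |z| ^ r) volume 0 c := by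
    intro c hc
    refine (intervalIntegral.intervalIntegrable_rpow' hr (a := 0) (b := c)).congr ?_
    intro z hz
    rw [uIoc_of_le hc] at hz
    simp only
    rw [abs_of_pos hz.1]
  intro c
  rcases le_total 0 c with h | h
  · exact h0 c h
  · rw [IntervalIntegrable.iff_comp_neg (a := 0) (b := c)]
    simpa using h0 (-c) (by linarith)

lemma aux_cont {p : ℝ} (hp : 0 < p) : Continuous (fun z : ℝ => |z| ^ (p - 1) * z) := by
  have h : ContDiff ℝ 1 (fun z : ℝ => ‖z‖ ^ (p + 1)) := contDiff_norm_rpow (by linarith)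
  have h2 := h.continuous_deriv le_rfl
  have h3 : deriv (fun z : ℝ => ‖z‖ ^ (p + 1)) = fun z => (p + 1) * (|z| ^ (p - 1) * z) := by
    ext z
    have := (hasDerivAt_abs_rpow z (show 1 < p + 1 by linarith)).deriv
    simp only [Real.norm_eq_abs]
    rw [this, show p + 1 - 2 = p - 1 by ring, mul_assoc]
  rw [h3] at h2
  have h4 : (fun z : ℝ => |z| ^ (p - 1) * z) = fun z => (p+1)⁻¹ * ((p + 1) * (|z| ^ (p - 1) * z)) := by
    ext z; field_simp
  rw [h4]
  exact h2.const_mul _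

lemma aux_deriv {p z : ℝ} (hz : z ≠ 0) :
    HasDerivAt (fun z : ℝ => |z| ^ (p - 1) * z) (p * |z| ^ (p - 1)) z := by
  have hz' : 0 < |z| := abs_pos.2 hz
  have h1 := ((hasDerivAt_abs hz).rpow_const (p := p - 1) (Or.inl hz'.ne')).mul (hasDerivAt_id z)
  refine h1.congr_deriv ?_
  have : |z| ^ (p - 1) = |z| ^ (p - 1 - 1) * |z| := by
    rw [← Real.rpow_add_one hz'.ne']; ring_nf
  simp only [id]
  rw [this]
  have : (SignType.sign z : ℝ) * z = |z| := by exact sign_mul_self z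
  linear_combination (p-1) * |z|^(p-1-1) * this

lemma aux_int1 {p : ℝ} (hp : 0 < p) (x s : ℝ) :
    ∫ y in (0:ℝ)..s, |x - y| ^ (p - 1) = (|x| ^ (p - 1) * x - |x - s| ^ (p - 1) * (x - s)) / p := by
  rw [intervalIntegral.integral_comp_sub_left (fun z => |z| ^ (p - 1)) x]
  have := MeasureTheory.integral_eq_of_hasDerivAt_off_countable (fun z : ℝ => |z| ^ (p - 1) * z)
    (fun z => p * |z| ^ (p - 1)) (a := x - s) (b := x) (countable_singleton 0)
    (aux_cont hp).continuousOn (fun z hz => aux_deriv (by simpa using hz.2))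
    ((aux_int (by linarith) _ _).const_mul p)
  rw [intervalIntegral.integral_const_mul] at this
  simp only [sub_zero]
  rw [← this]; field_simp

lemma aux_int2 {p : ℝ} (hp : 0 < p) (b c : ℝ) :
    ∫ z in b..c, |z| ^ (p - 1) * z = (|c| ^ (p + 1) - |b| ^ (p + 1)) / (p + 1) := by
  have := intervalIntegral.integral_eq_sub_of_hasDerivAt (a := b) (b := c)
    (fun z _ => hasDerivAt_abs_rpow z (show 1 < p + 1 by linarith))
    (by
      simp only [mul_assoc, show p + 1 - 2 = p - 1 by ring]
      exact ((aux_cont hp).const_mul (p+1)).intervalIntegrable _ _)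
  simp only [mul_assoc, show p + 1 - 2 = p - 1 by ring] at this
  rw [intervalIntegral.integral_const_mul] at this
  rw [← this]; field_simp

lemma aux_double {p s t : ℝ} (hp : 0 < p) (hs : 0 < s) (ht : 0 < t) :
    ∫⁻ x in Ioc (0:ℝ) t, ∫⁻ y in Ioc (0:ℝ) s, ENNReal.ofReal (|x - y| ^ (p - 1))
      = ENNReal.ofReal ((t ^ (p + 1) + s ^ (p + 1) - |t - s| ^ (p + 1)) / (p * (p + 1))) := by
  have h1 : ∀ x, ∫⁻ y in Ioc (0:ℝ) s, ENNReal.ofReal (|x - y| ^ (p - 1))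
      = ENNReal.ofReal ((|x| ^ (p - 1) * x - |x - s| ^ (p - 1) * (x - s)) / p) := by
    intro x
    rw [← aux_int1 hp, intervalIntegral.integral_of_le hs.le, ofReal_integral_eq_lintegral_ofReal]
    · rw [← IntegrableOn, ← intervalIntegrable_iff_integrableOn_Ioc_of_le hs.le]
      have := (aux_int (show -1 < p - 1 by linarith) x (x - s)).comp_sub_left x
      simpa using this
    · exact Filter.Eventually.of_forall fun y => by positivity
  have hn : ∀ x, 0 ≤ (|x| ^ (p - 1) * x - |x - s| ^ (p - 1) * (x - s)) / p := by
    intro x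
    rw [← aux_int1 hp]
    exact intervalIntegral.integral_nonneg hs.le fun y _ => by positivity
  have hc := aux_cont hp
  have hc2 : Continuous fun x : ℝ => |x - s| ^ (p - 1) * (x - s) := hc.comp (continuous_id.sub continuous_const)
  simp_rw [h1]
  rw [← ofReal_integral_eq_lintegral_ofReal, ← intervalIntegral.integral_of_le ht.le]
  · congr 1
    rw [intervalIntegral.integral_div, intervalIntegral.integral_sub (hc.intervalIntegrable _ _)
      (hc2.intervalIntegrable _ _), aux_int2 hp,
      intervalIntegral.integral_comp_sub_right (fun z => |z| ^ (p - 1) * z) s, aux_int2 hp]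
    simp only [abs_zero, zero_sub, abs_neg, abs_of_pos hs, abs_of_pos ht]
    rw [Real.zero_rpow (by linarith)]
    field_simp
    ring
  · rw [← IntegrableOn, ← intervalIntegrable_iff_integrableOn_Ioc_of_le ht.le]
    exact ((hc.sub hc2).div_const p).intervalIntegrable _ _
  · exact Filter.Eventually.of_forall hn

lemma aux_K {a t u : ℝ} (hu : 0 < u) (hut : u < t) :
    u ^ (-a) * ∫ x in u..t, (x - u) ^ (a - 1) * x ^ a
      = (∫⁻ x in Ioc (0:ℝ) t, fbmG a u x).toReal := by
  rw [← intervalIntegral.integral_const_mul, intervalIntegral.integral_of_le hut.le,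
    integral_eq_lintegral_of_nonneg_ae]
  · congr 1
    have : Ioc u t = Ioi u ∩ Ioc 0 t := by
      ext x; simp only [mem_Ioc, mem_inter_iff, mem_Ioi]
      constructor
      · rintro ⟨h1, h2⟩; exact ⟨h1, hu.trans h1, h2⟩
      · rintro ⟨h1, _, h2⟩; exact ⟨h1, h2⟩
    rw [this, ← Measure.restrict_restrict measurableSet_Ioi, ← lintegral_indicator measurableSet_Ioi]
    refine lintegral_congr fun x => ?_
    simp only [indicator, mem_Ioi, fbmG, mul_assoc]
  · refine (ae_restrict_iff' measurableSet_Ioc).2 (Filter.Eventually.of_forall ?_)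
    rintro x ⟨h1, h2⟩
    have h3 : 0 < x - u := by linarith
    have h4 : 0 < x := by linarith
    simp only [Pi.zero_apply]
    positivity
  · exact Measurable.aestronglyMeasurable (by fun_prop)

lemma aux_triple {a s t : ℝ} (ha : 0 < a) (ha2 : a < 1/2) (hs : 0 < s) (ht : 0 < t) :
    ∫⁻ u in Ioi (0:ℝ), (∫⁻ x in Ioc (0:ℝ) t, fbmG a u x) * (∫⁻ y in Ioc (0:ℝ) s, fbmG a u y)
      = ENNReal.ofReal (ProbabilityTheory.beta (1 - 2 * a) a) *
        ENNReal.ofReal ((t ^ (2 * a + 1) + s ^ (2 * a + 1) - |t - s| ^ (2 * a + 1)) /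
          (2 * a * (2 * a + 1))) := by
  have hm := fbmG_meas a
  have hmu : ∀ u, Measurable (fbmG a u) := fun u => hm.comp (measurable_const.prodMk measurable_id)
  have hb := ProbabilityTheory.beta_pos (show 0 < 1 - 2 * a by linarith) ha
  have hmA : Measurable fun u => ∫⁻ y in Ioc (0:ℝ) s, fbmG a u y := Measurable.lintegral_prod_right hm
  have e1 : ∀ u, (∫⁻ x in Ioc (0:ℝ) t, fbmG a u x) * (∫⁻ y in Ioc (0:ℝ) s, fbmG a u y)
      = ∫⁻ x in Ioc (0:ℝ) t, fbmG a u x * ∫⁻ y in Ioc (0:ℝ) s, fbmG a u y :=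
    fun u => (lintegral_mul_const _ (hmu u)).symm
  simp_rw [e1]
  rw [lintegral_lintegral_swap
    ((hm.mul (hmA.comp measurable_fst)).aemeasurable)]
  rw [← aux_double (by linarith) hs ht, ← lintegral_const_mul]
  · refine setLIntegral_congr_fun measurableSet_Ioc ?_
    rintro x ⟨hx, -⟩
    simp only
    simp_rw [← lintegral_const_mul _ (hmu _)]
    rw [lintegral_lintegral_swap, ← lintegral_const_mul _ (by fun_prop)]
    · refine lintegral_congr_ae ?_
      have h0 : ∀ᵐ y ∂(volume.restrict (Ioc (0:ℝ) s)), y ≠ x :=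
        ae_restrict_of_ae (by simp [ae_iff])
      filter_upwards [h0, ae_restrict_mem measurableSet_Ioc] with y hy hy2
      rw [aux_inner2 ha ha2 hx hy2.1 hy.symm, ENNReal.ofReal_mul hb.le]
    · exact (Measurable.mul (hm.comp (measurable_fst.prodMk measurable_const)) hm).aemeasurable
  · exact Measurable.lintegral_prod_right (f := fun x y : ℝ => ENNReal.ofReal (|x - y| ^ (2 * a - 1))) (by fun_prop)

/-- The Volterra kernel representation of the fractional Brownian covariance:
with `c_H² = H(2H-1)/β(2-2H, H-1/2)` and
`K_H(t,s) = c_H s^{1/2-H} ∫ₛᵗ (u-s)^{H-3/2} u^{H-1/2} du` for `0 < s < t` (and `0` for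
`s ≥ t`), one has `∫₀^{s∧t} K_H(t,u) K_H(s,u) du = (t^{2H} + s^{2H} - |t-s|^{2H})/2`. -/
theorem fbm_kernel_covariance_representation
    (H : ℝ) (hH : H ∈ Set.Ioo (1/2 : ℝ) 1)
    (c : ℝ) (hc : 0 < c)
    (hc2 : c ^ 2 = H * (2*H - 1) /
      (Real.Gamma (2 - 2*H) * Real.Gamma (H - 1/2) / Real.Gamma ((2 - 2*H) + (H - 1/2))))
    (K : ℝ → ℝ → ℝ)
    (hK₁ : ∀ t s : ℝ, 0 < s → s < t →
      K t s = c * s ^ ((1:ℝ)/2 - H) * ∫ u in s..t, (u - s) ^ (H - 3/2) * u ^ (H - 1/2))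
    (hK₂ : ∀ t s : ℝ, t ≤ s → K t s = 0) :
    ∀ s t : ℝ, 0 < s → 0 < t →
      (∫ u in (0:ℝ)..(min s t), K t u * K s u)
        = (t ^ (2*H) + s ^ (2*H) - |t - s| ^ (2*H)) / 2 := by
  obtain ⟨hH1, hH2⟩ := hH
  intro s t hs ht
  obtain ⟨a, rfl⟩ : ∃ a, H = a + 1/2 := ⟨H - 1/2, by ring⟩
  have ha : 0 < a := by linarith
  have ha2 : a < 1/2 := by linarith
  have hKe : ∀ t u : ℝ, 0 < u → K t u = c * (∫⁻ x in Ioc (0:ℝ) t, fbmG a u x).toReal := by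
    intro t u hu
    rcases lt_or_ge u t with h | h
    · rw [hK₁ t u hu h, ← aux_K hu h, mul_assoc, show (1:ℝ)/2 - (a + 1/2) = -a by ring,
        show a + 1/2 - 3/2 = a - 1 by ring, show a + 1/2 - 1/2 = a by ring]
    · rw [hK₂ t u h, setLIntegral_eq_zero measurableSet_Ioc]
      · simp
      · rintro x ⟨_, hx⟩
        simp [fbmG, not_lt.2 (hx.trans h)]
  have hb := ProbabilityTheory.beta_pos (show 0 < 1 - 2 * a by linarith) ha
  have hT := aux_triple ha ha2 hs ht
  have hm := fbmG_meas a
  have hmA : ∀ s, Measurable fun u => ∫⁻ y in Ioc (0:ℝ) s, fbmG a u y :=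
    fun s => Measurable.lintegral_prod_right hm
  have hc3 : c ^ 2 = (a + 1/2) * (2 * a) / ProbabilityTheory.beta (1 - 2 * a) a := by
    rw [hc2, ProbabilityTheory.beta]
    ring_nf
  rw [intervalIntegral.integral_of_le (le_min hs.le ht.le),
    ← setIntegral_eq_of_subset_of_forall_sdiff_eq_zero (t := Ioi 0) measurableSet_Ioi
      Ioc_subset_Ioi_self]
  · have h1 : ∫ u in Ioi (0:ℝ), K t u * K s u = ∫ u in Ioi (0:ℝ),
        c ^ 2 * ((∫⁻ x in Ioc (0:ℝ) t, fbmG a u x) * (∫⁻ y in Ioc (0:ℝ) s, fbmG a u y)).toReal := by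
      refine setIntegral_congr_fun measurableSet_Ioi fun u hu => ?_
      rw [hKe t u hu, hKe s u hu, ENNReal.toReal_mul]
      ring
    have hM : Measurable fun u => (∫⁻ x in Ioc (0:ℝ) t, fbmG a u x) *
        (∫⁻ y in Ioc (0:ℝ) s, fbmG a u y) := (hmA t).mul (hmA s)
    have hfin : ∀ᵐ u ∂(volume.restrict (Ioi (0:ℝ))), (∫⁻ x in Ioc (0:ℝ) t, fbmG a u x) *
        (∫⁻ y in Ioc (0:ℝ) s, fbmG a u y) < ⊤ :=
      ae_lt_top hM (by rw [hT]; exact ENNReal.mul_ne_top ENNReal.ofReal_ne_top ENNReal.ofReal_ne_top)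
    rw [h1, MeasureTheory.integral_const_mul, integral_toReal hM.aemeasurable hfin,
      hT, ENNReal.toReal_mul, ENNReal.toReal_ofReal hb.le, ENNReal.toReal_ofReal, hc3]
    · rw [show 2 * (a + 1/2) = 2 * a + 1 by ring]
      generalize ProbabilityTheory.beta (1 - 2 * a) a = B at hb
      generalize t ^ (2 * a + 1) + s ^ (2 * a + 1) - |t - s| ^ (2 * a + 1) = E
      field_simp
    · apply div_nonneg _ (by positivity)
      have : |t - s| ^ (2 * a + 1) ≤ (max t s) ^ (2 * a + 1) := by
        apply Real.rpow_le_rpow (abs_nonneg _) _ (by linarith)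
        rw [abs_le]
        constructor
        · linarith [le_max_right t s]
        · linarith [le_max_left t s]
      have h1 : 0 < t ^ (2 * a + 1) := by positivity
      have h2 : 0 < s ^ (2 * a + 1) := by positivity
      rcases max_choice t s with h | h <;> rw [h] at this <;> linarith
  · rintro u ⟨hu, hu2⟩
    have hu : 0 < u := hu
    have h3 : min s t < u := by
      by_contra h
      exact hu2 ⟨hu, not_lt.1 h⟩
    rcases min_lt_iff.1 h3 with h | h
    · rw [hK₂ s u h.le, mul_zero]
    · rw [hK₂ t u h.le, zero_mul]
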